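/- Let 0 < α < 1 and 0 < β < α^2. There is an absolute constant C such that for every positive integer m, the number of divisors d of m with m^α ≤ d ≤ m^α + m^β is at most C/(α^2 − β). -/

import Mathlib

open ArithmeticFunction in
theorem log_eq_sum_divisors_vonMangoldt_ite {m d : ℕ} (hm : m ≠ 0) (hd : d ∣ m) :
    Real.log d = ∑ e ∈ m.divisors, vonMangoldt e * (if e ∣ d then 1 else 0) := by
  rw [← vonMangoldt_sum]
  simp only [mul_ite, mul_one, mul_zero]
  rw [← Finset.sum_filter, Nat.divisors_filter_dvd_of_dvd hm hd]

open ArithmeticFunction in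
/-- The sum of `log (gcd a b)` over all pairs from a set of divisors of `m` is bounded below
by a Cauchy–Schwarz argument over the prime powers dividing `m`. -/
theorem sq_sum_log_le_log_mul_sum_log_gcd {m : ℕ} (hm : m ≠ 0) {D : Finset ℕ}
    (hD : ∀ d ∈ D, d ∣ m) :
    (∑ d ∈ D, Real.log d) ^ 2 ≤
      Real.log m * ∑ a ∈ D, ∑ b ∈ D, Real.log (Nat.gcd a b) := by
  set S : ℕ → ℝ := fun e => ∑ d ∈ D, if e ∣ d then 1 else 0 with hS
  have hsum : ∑ d ∈ D, Real.log d = ∑ e ∈ m.divisors, vonMangoldt e * S e := by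
    rw [Finset.sum_congr rfl fun d hd => log_eq_sum_divisors_vonMangoldt_ite hm (hD d hd),
      Finset.sum_comm]
    simp only [hS, Finset.mul_sum]
  have hgcd : ∑ a ∈ D, ∑ b ∈ D, Real.log (Nat.gcd a b) =
      ∑ e ∈ m.divisors, vonMangoldt e * S e ^ 2 := by
    have hpair : ∀ a ∈ D, ∀ b ∈ D, Real.log (Nat.gcd a b) = ∑ e ∈ m.divisors,
        vonMangoldt e * ((if e ∣ a then 1 else 0) * (if e ∣ b then 1 else 0)) := by
      intro a ha b _
      rw [log_eq_sum_divisors_vonMangoldt_ite hm ((Nat.gcd_dvd_left a b).trans (hD a ha))]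
      simp only [Nat.dvd_gcd_iff, ite_and, ite_mul, one_mul, zero_mul]
    rw [Finset.sum_congr rfl fun a ha => Finset.sum_congr rfl (hpair a ha),
      Finset.sum_congr rfl fun a _ => Finset.sum_comm, Finset.sum_comm]
    simp_rw [hS, sq, Finset.sum_mul_sum, Finset.mul_sum]
  rw [hsum, hgcd, ← vonMangoldt_sum]
  refine Finset.sum_sq_le_sum_mul_sum_of_sq_le_mul _ (fun _ _ => vonMangoldt_nonneg)
    (fun _ _ => mul_nonneg vonMangoldt_nonneg (sq_nonneg _)) fun _ _ => le_of_eq (by ring)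

theorem gcd_le_of_abs_sub_le {a b : ℕ} (hab : a ≠ b) {x : ℝ} (h : |(a : ℝ) - b| ≤ x) :
    (Nat.gcd a b : ℝ) ≤ x := by
  have hdvd : (Nat.gcd a b : ℤ) ∣ (a : ℤ) - b :=
    dvd_sub (by exact_mod_cast Nat.gcd_dvd_left a b) (by exact_mod_cast Nat.gcd_dvd_right a b)
  have hpos : 0 < |(a : ℤ) - b| := abs_pos.mpr (sub_ne_zero.mpr (by exact_mod_cast hab))
  have hle := Int.le_of_dvd hpos ((dvd_abs _ _).mpr hdvd)
  refine le_trans ?_ h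
  exact_mod_cast hle

theorem sum_log_gcd_le {D : Finset ℕ} {c : ℝ}
    (h : ∀ a ∈ D, ∀ b ∈ D, a ≠ b → Real.log (Nat.gcd a b) ≤ c) :
    ∑ a ∈ D, ∑ b ∈ D, Real.log (Nat.gcd a b) ≤
      ∑ d ∈ D, Real.log d + ((D.card : ℝ) ^ 2 - D.card) * c := by
  calc ∑ a ∈ D, ∑ b ∈ D, Real.log (Nat.gcd a b)
      ≤ ∑ a ∈ D, (Real.log a + ((D.card : ℝ) - 1) * c) := by
        refine Finset.sum_le_sum fun a ha => ?_
        rw [← Finset.add_sum_erase _ _ ha, Nat.gcd_self]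
        have hle := Finset.sum_le_card_nsmul (D.erase a)
          (fun b => Real.log (Nat.gcd a b)) c fun b hb =>
            h a ha b (Finset.mem_of_mem_erase hb) (Finset.ne_of_mem_erase hb).symm
        rw [nsmul_eq_mul, Finset.cast_card_erase_of_mem ha] at hle
        linarith
    _ = _ := by
        rw [Finset.sum_add_distrib, Finset.sum_const, nsmul_eq_mul]
        ring

theorem divisors_in_short_interval :
    ∃ C : ℝ, 0 < C ∧ ∀ α β : ℝ, 0 < α → α < 1 → 0 < β → β < α ^ 2 →
      ∀ m : ℕ, 0 < m →
        (((m.divisors.filter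
            (fun d : ℕ => (m : ℝ) ^ α ≤ (d : ℝ) ∧
              (d : ℝ) ≤ (m : ℝ) ^ α + (m : ℝ) ^ β)).card : ℝ)) ≤
          C / (α ^ 2 - β) := by
  refine ⟨1, one_pos, fun α β hα hα1 hβ hβα m hm => ?_⟩
  set D := m.divisors.filter (fun d : ℕ => (m : ℝ) ^ α ≤ (d : ℝ) ∧
    (d : ℝ) ≤ (m : ℝ) ^ α + (m : ℝ) ^ β) with hD
  rw [le_div_iff₀ (by linarith)]
  have hk0 : (0 : ℝ) ≤ D.card := Nat.cast_nonneg _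
  have hsq : α ^ 2 ≤ α := by nlinarith
  rcases lt_or_ge ((D.card : ℝ) * α) 1 with hk | hk
  · nlinarith
  obtain rfl | hm1 : m = 1 ∨ 1 < m := by omega
  · have hcard : (D.card : ℝ) ≤ 1 := by
      exact_mod_cast (Finset.card_filter_le _ _).trans (by simp)
    nlinarith
  have hmpos : (0 : ℝ) < m := by exact_mod_cast hm
  have hL : 0 < Real.log m := Real.log_pos (by exact_mod_cast hm1)
  have hmem : ∀ d ∈ D, d ∣ m ∧ (m : ℝ) ^ α ≤ d ∧ (d : ℝ) ≤ (m : ℝ) ^ α + (m : ℝ) ^ β := by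
    intro d hd
    rw [hD, Finset.mem_filter, Nat.mem_divisors] at hd
    exact ⟨hd.1.1, hd.2⟩
  have hlower : (D.card : ℝ) * (α * Real.log m) ≤ ∑ d ∈ D, Real.log d := by
    rw [← nsmul_eq_mul]
    refine Finset.card_nsmul_le_sum _ _ _ fun d hd => ?_
    rw [← Real.log_rpow hmpos]
    exact Real.log_le_log (Real.rpow_pos_of_pos hmpos _) (hmem d hd).2.1
  have hupper := sum_log_gcd_le (D := D) (c := β * Real.log m) fun a ha b hb hab => by
    obtain ⟨hdvd, ha₁, ha₂⟩ := hmem a ha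
    obtain ⟨-, hb₁, hb₂⟩ := hmem b hb
    rw [← Real.log_rpow hmpos]
    refine Real.log_le_log ?_ (gcd_le_of_abs_sub_le hab ?_)
    · exact_mod_cast Nat.gcd_pos_of_pos_left b (Nat.pos_of_dvd_of_pos hdvd hm)
    · rw [abs_le]
      constructor <;> linarith
  have hCS := sq_sum_log_le_log_mul_sum_log_gcd hm.ne' fun d hd => (hmem d hd).1
  generalize (D.card : ℝ) = k at *
  generalize Real.log m = L at *
  generalize ∑ d ∈ D, Real.log d = T at *
  have hT : T * (T - L) ≤ (k ^ 2 - k) * β * L ^ 2 := by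
    nlinarith [mul_le_mul_of_nonneg_left hupper hL.le]
  have hkT : (k * α * L) * (k * α * L - L) ≤ T * (T - L) := by
    have hnonneg : 0 ≤ k * α * L - L := by nlinarith
    apply mul_le_mul <;> nlinarith
  have hmain : k * (k * α ^ 2 - α) ≤ k * ((k - 1) * β) := by
    refine le_of_mul_le_mul_right ?_ (pow_pos hL 2)
    linarith
  have hkpos : 0 < k := by
    by_contra! hneg
    nlinarith
  linarith [le_of_mul_le_mul_left hmain hkpos]
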